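/- arXiv:2301.09675 — 2 statements merged into one kernel-verified Lean document; each statement's English description precedes it below -/
import Mathlib

section
/- (One outer loop.) Under the stated epoch setup, for every u ∈ ℝ^l: (1/τ_{1,s}) Σ_{k=sl}^{sl+l−1} E⟨∇φ(v_{k+1}), v_{k+1} − u⟩ + (τ₂/τ_{1,s+1}²) Σ_{k=sl}^{sl+l−2} E[φ(y_{k+1}) − φ*] + ((1 − τ_{1,s+1})/τ_{1,s+1}²) E[φ(y_{(s+1)l}) − φ*] ≤ (1/τ_{1,s}) Σ_{k=sl}^{sl+l−1} E[φ(v_{k+1}) − φ*] + ((1 − τ_{1,s})/τ_{1,s}²) E[φ(y_{sl}) − φ*] + (τ₂/τ_{1,s}²) Σ_{k=sl−l}^{sl−2} (φ(y_{k+1}) − φ*) + 9 L̄ ( E[V_{z_{sl}}(u)] − E[V_{z_{(s+1)l}}(u)] ). -/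
open scoped RealInnerProductSpace BigOperators

section NormBounds

variable {E : Type*} [NormedAddCommGroup E] [InnerProductSpace ℝ E]

/-- On a finite-dimensional space every linear functional is bounded with respect to any norm. -/
lemma LinearMap.exists_forall_le_mul_of_norm {E : Type*} [AddCommGroup E] [Module ℝ E]
    [FiniteDimensional ℝ E] (N : E → ℝ) (hN : ∀ x, N x = 0 ↔ x = 0)
    (hsmul : ∀ (c : ℝ) x, N (c • x) = |c| * N x) (htri : ∀ x y, N (x + y) ≤ N x + N y)
    (f : E →ₗ[ℝ] ℝ) : ∃ C, 0 ≤ C ∧ ∀ x, f x ≤ C * N x := by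
  let p : AddGroupNorm E :=
    { toFun := N
      map_zero' := (hN 0).2 rfl
      add_le' := htri
      neg' := fun x => by simpa using hsmul (-1) x
      eq_zero_of_map_eq_zero' := fun x => (hN x).1 }
  let : NormedAddCommGroup E := AddGroupNorm.toNormedAddCommGroup p
  let : NormedSpace ℝ E := { norm_smul_le := fun c x => (hsmul c x).le }
  let F : E →L[ℝ] ℝ := LinearMap.toContinuousLinearMap f
  exact ⟨‖F‖, norm_nonneg F, fun x => (le_abs_self _).trans (F.le_opNorm x)⟩

lemma norm_fun_nonneg {N : E → ℝ} (hsmul : ∀ (c : ℝ) x, N (c • x) = |c| * N x)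
    (htri : ∀ x y, N (x + y) ≤ N x + N y) (x : E) : 0 ≤ N x := by
  have h0 : N 0 = 0 := by simpa using hsmul 0 0
  have hneg : N (-x) = N x := by simpa using hsmul (-1) x
  have := htri x (-x)
  rw [add_neg_cancel, h0, hneg] at this
  linarith

/-- The Hölder-type inequality between a norm and its dual norm. -/
lemma inner_le_dual_mul [FiniteDimensional ℝ E] {N Nd : E → ℝ} (hN : ∀ x, N x = 0 ↔ x = 0)
    (hsmul : ∀ (c : ℝ) x, N (c • x) = |c| * N x) (htri : ∀ x y, N (x + y) ≤ N x + N y)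
    (hNd : ∀ u, Nd u = sSup ((fun v => ⟪u, v⟫) '' {v | N v ≤ 1})) (u v : E) :
    ⟪u, v⟫ ≤ Nd u * N v := by
  rcases eq_or_ne v 0 with rfl | hv
  · simp [(hN 0).2 rfl]
  have hpos : 0 < N v :=
    lt_of_le_of_ne (norm_fun_nonneg hsmul htri v) fun h => hv ((hN v).1 h.symm)
  obtain ⟨C, hC, hbound⟩ :=
    LinearMap.exists_forall_le_mul_of_norm N hN hsmul htri (innerₗ E u)
  have hbdd : BddAbove ((fun v => ⟪u, v⟫) '' {v | N v ≤ 1}) := by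
    refine ⟨C, ?_⟩
    rintro _ ⟨x, hx, rfl⟩
    exact (hbound x).trans (mul_le_of_le_one_right hC hx)
  have hunit : N ((N v)⁻¹ • v) ≤ 1 := by
    rw [hsmul, abs_of_pos (inv_pos.2 hpos), inv_mul_cancel₀ hpos.ne']
  have := le_csSup hbdd ⟨_, hunit, rfl⟩
  rw [← hNd] at this
  simp only [inner_smul_right] at this
  rwa [inv_mul_le_iff₀ hpos, mul_comm] at this

end NormBounds

section SmoothConvex

variable {E : Type*} [NormedAddCommGroup E] [InnerProductSpace ℝ E] [CompleteSpace E]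

lemma HasGradientAt.hasDerivAt_line {f : E → ℝ} {g : E} {x d : E} {t : ℝ}
    (h : HasGradientAt f g (x + t • d)) :
    HasDerivAt (fun r : ℝ => f (x + r • d)) ⟪g, d⟫ t := by
  have hline : HasDerivAt (fun r : ℝ => x + r • d) d t := by
    simpa using ((hasDerivAt_id t).smul_const d).const_add x
  exact (h.hasFDerivAt.comp_hasDerivAt t hline).congr_deriv (by simp)

lemma ConvexOn.add_inner_gradient_le {f : E → ℝ} (hf : ConvexOn ℝ Set.univ f) {x g : E}
    (h : HasGradientAt f g x) (y : E) : f x + ⟪g, y - x⟫ ≤ f y := by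
  have hconv : ConvexOn ℝ Set.univ (fun r : ℝ => f (x + r • (y - x))) := by
    have := hf.comp_affineMap (AffineMap.lineMap x y : ℝ →ᵃ[ℝ] E)
    simpa [Function.comp_def, AffineMap.lineMap_apply, add_comm] using this
  have hd : HasDerivAt (fun r : ℝ => f (x + r • (y - x))) ⟪g, y - x⟫ 0 :=
    HasGradientAt.hasDerivAt_line (by simpa using h)
  have := hconv.le_slope_of_hasDerivAt (Set.mem_univ 0) (Set.mem_univ 1) zero_lt_one hd
  simp [slope_def_field] at this
  linarith

/-- The descent lemma for a function whose gradient is Lipschitz from `N` to its dual norm. -/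
lemma le_add_inner_add_sq_of_smooth {N : E → ℝ} (hsmul : ∀ (c : ℝ) x, N (c • x) = |c| * N x)
    {f : E → ℝ} {g : E → E} {K : ℝ} (hg : ∀ x, HasGradientAt f (g x) x)
    (hK : ∀ x y d, ⟪g x - g y, d⟫ ≤ K * N (x - y) * N d) (x y : E) :
    f y ≤ f x + ⟪g x, y - x⟫ + K / 2 * N (y - x) ^ 2 := by
  set d := y - x with hd
  let ψ : ℝ → ℝ := fun t => f (x + t • d) - t * ⟪g x, d⟫ - t ^ 2 * (K / 2 * N d ^ 2)
  have hψ : ∀ t, HasDerivAt ψ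
      (⟪g (x + t • d), d⟫ - ⟪g x, d⟫ - 2 * t * (K / 2 * N d ^ 2)) t := by
    intro t
    have h1 := (hg (x + t • d)).hasDerivAt_line
    have h2 := (hasDerivAt_id t).mul_const ⟪g x, d⟫
    have h3 := (hasDerivAt_pow 2 t).mul_const (K / 2 * N d ^ 2)
    exact ((h1.sub h2).sub h3).congr_deriv (by simp)
  have hanti : AntitoneOn ψ (Set.Icc 0 1) := by
    refine antitoneOn_of_deriv_nonpos (convex_Icc 0 1)
      (fun t _ => (hψ t).continuousAt.continuousWithinAt)
      (fun t _ => (hψ t).differentiableAt.differentiableWithinAt) fun t ht => ?_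
    rw [interior_Icc] at ht
    have := hK (x + t • d) x d
    rw [add_sub_cancel_left, hsmul, abs_of_pos ht.1, inner_sub_left] at this
    rw [(hψ t).deriv]
    linarith
  have := hanti (Set.left_mem_Icc.2 zero_le_one) (Set.right_mem_Icc.2 zero_le_one) zero_le_one
  simp [ψ, hd] at this
  linarith

/-- The optimality condition of a mirror step combined with the three-point identity. -/
lemma inner_sub_eq_bregman_of_isMin {w : E → ℝ} {gw : E → E}
    (hw : ∀ x, HasGradientAt w (gw x) x) {V : E → E → ℝ}
    (hV : ∀ x y, V x y = w y - w x - ⟪gw x, y - x⟫) {c : ℝ} {a x z : E}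
    (hmin : ∀ y, c * V x z + ⟪a, z⟫ ≤ c * V x y + ⟪a, y⟫) (u : E) :
    ⟪a, z - u⟫ = c * (V x u - V z u - V x z) := by
  have hline : HasDerivAt (fun r : ℝ => c * V x (z + r • (u - z)) + ⟪a, z + r • (u - z)⟫)
      (c * (⟪gw z, u - z⟫ - ⟪gw x, u - z⟫) + ⟪a, u - z⟫) 0 := by
    have h1 : HasDerivAt (fun r : ℝ => w (z + r • (u - z))) ⟪gw z, u - z⟫ 0 :=
      HasGradientAt.hasDerivAt_line (by simpa using hw z)
    have hlin : ∀ b : E, HasDerivAt (fun r : ℝ => r * ⟪b, u - z⟫) ⟪b, u - z⟫ 0 := by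
      intro b
      simpa using (hasDerivAt_id (0 : ℝ)).mul_const ⟪b, u - z⟫
    have h2 := (((h1.sub (hlin (gw x))).add_const (-w x - ⟪gw x, z - x⟫)).const_mul c).add
      ((hlin a).add_const ⟪a, z⟫)
    refine h2.congr_of_eventuallyEq (Filter.Eventually.of_forall fun r => ?_)
    simp only [hV, Pi.add_apply, Pi.sub_apply, inner_add_right, inner_sub_right,
      inner_smul_right]
    ring
  have hloc : IsLocalMin
      (fun r : ℝ => c * V x (z + r • (u - z)) + ⟪a, z + r • (u - z)⟫) 0 :=
    Filter.Eventually.of_forall fun r => by simpa using hmin (z + r • (u - z))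
  have h0 := hloc.hasDerivAt_eq_zero hline
  simp only [hV, inner_sub_right] at h0 ⊢
  linarith

end SmoothConvex

section Sampling

/-- Independence of coordinates of a product distribution on a finite set: a coordinate may be
averaged out of a function whose remaining dependence ignores that coordinate. -/
lemma sum_prod_mul_eq_sum_prod_mul_sum {n : ℕ} {ι : Type*} [Fintype ι] [DecidableEq ι]
    {p : ι → ℝ} (hp : ∑ i, p i = 1) (j : Fin n) (h : ι → (Fin n → ι) → ℝ)
    (hh : ∀ i ω a, h i (Function.update ω j a) = h i ω) :
    ∑ ω : Fin n → ι, (∏ k, p (ω k)) * h (ω j) ω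
      = ∑ ω : Fin n → ι, (∏ k, p (ω k)) * ∑ i, p i * h i ω := by
  let e : (Fin n → ι) × ι → (Fin n → ι) × ι := fun q => (Function.update q.1 j q.2, q.1 j)
  have he : Function.Involutive e := by
    rintro ⟨ω, a⟩
    simp [e]
  have hW : ∀ (ω : Fin n → ι) a,
      (∏ k, p (Function.update ω j a k)) * p (ω j) = (∏ k, p (ω k)) * p a := by
    intro ω a
    rw [← Finset.mul_prod_erase _ _ (Finset.mem_univ j),
      ← Finset.mul_prod_erase _ (fun k => p (ω k)) (Finset.mem_univ j), Function.update_self,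
      Finset.prod_congr rfl fun k hk => by rw [Function.update_of_ne (Finset.ne_of_mem_erase hk)]]
    ring
  calc ∑ ω : Fin n → ι, (∏ k, p (ω k)) * h (ω j) ω
      = ∑ q : (Fin n → ι) × ι, (∏ k, p (q.1 k)) * p q.2 * h (q.1 j) q.1 := by
        rw [Fintype.sum_prod_type]
        refine Finset.sum_congr rfl fun ω _ => ?_
        dsimp only
        rw [← Finset.sum_mul, ← Finset.mul_sum, hp, mul_one]
    _ = ∑ q : (Fin n → ι) × ι, (∏ k, p (q.1 k)) * p q.2 * h q.2 q.1 := by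
        rw [← Equiv.sum_comp he.toPerm]
        refine Finset.sum_congr rfl fun q _ => ?_
        simp [e, hW, hh]
    _ = _ := by
        rw [Fintype.sum_prod_type]
        refine Finset.sum_congr rfl fun ω _ => ?_
        rw [Finset.mul_sum]
        exact Finset.sum_congr rfl fun i _ => by ring

lemma sum_prod_eq_one {n : ℕ} {ι : Type*} [Fintype ι] {p : ι → ℝ} (hp : ∑ i, p i = 1) :
    ∑ ω : Fin n → ι, ∏ k, p (ω k) = 1 := by
  classical
  rw [← Fintype.piFinset_univ, Finset.sum_prod_piFinset]
  simp [hp]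

end Sampling

section Step

variable {E : Type*} [NormedAddCommGroup E] [InnerProductSpace ℝ E]

/-- Cocoercivity in conjugate form. -/
lemma inner_sub_le_bregman_add_sq {N : E → ℝ} (hsmul : ∀ (c : ℝ) x, N (c • x) = |c| * N x)
    {f : E → ℝ} {g : E → E} {K : ℝ} (hconv : ∀ x y, f x + ⟪g x, y - x⟫ ≤ f y)
    (hdesc : ∀ x y, f y ≤ f x + ⟪g x, y - x⟫ + K / 2 * N (y - x) ^ 2) (x y d : E) :
    ⟪g x - g y, d⟫ ≤ (f x - f y - ⟪g y, x - y⟫) / 4 + 2 * K * N d ^ 2 := by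
  have h1 := hdesc x (x - (4 : ℝ) • d)
  have h2 := hconv y (x - (4 : ℝ) • d)
  have h3 : N (x - (4 : ℝ) • d - x) = 4 * N d := by
    rw [show x - (4 : ℝ) • d - x = (-4 : ℝ) • d by module, hsmul]
    norm_num
  rw [h3] at h1
  simp only [inner_sub_left, inner_sub_right, inner_smul_right] at h1 h2 ⊢
  linarith

/-- The value at a linearly coupled gradient step, before averaging over the sampled
component. -/
lemma coupled_step_le {N : E → ℝ} (hsmul : ∀ (c : ℝ) x, N (c • x) = |c| * N x)
    {f fi : E → ℝ} {g gi : E → E} {L Li τ : ℝ} (hL : 0 < L) (hLi : 0 < Li) (hτ : 0 < τ)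
    {x v a y z z' u : E} {V : E → E → ℝ} (hf : f y ≤ f v + ⟪g v, y - v⟫ + L / 2 * N (y - v) ^ 2)
    (hcoco : ∀ d, ⟪g x - g v, d⟫ ≤ (f x - f v - ⟪g v, x - v⟫) / 4 + 2 * L * N d ^ 2)
    (hcocoi : ∀ d, ⟪gi x - gi v, d⟫ ≤ (fi x - fi v - ⟪gi v, x - v⟫) / 4 + 2 * Li * N d ^ 2)
    (ha : a = g x + (L / Li) • (gi v - gi x))
    (hy : ∀ y', (9 * L / 2) * N (y - v) ^ 2 + ⟪a, y⟫
      ≤ (9 * L / 2) * N (y' - v) ^ 2 + ⟪a, y'⟫)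
    (hmirror : ⟪a, z' - u⟫ = (9 * τ * L) * (V z u - V z' u - V z z'))
    (hV : 1 / 2 * N (z' - z) ^ 2 ≤ V z z') :
    f y ≤ f v + (f x - f v - ⟪g v, x - v⟫) / 4
      + L / Li * ((fi x - fi v - ⟪gi v, x - v⟫) / 4) - τ * ⟪a, z - u⟫
      + 9 * L * τ ^ 2 * (V z u - V z' u) := by
  have hstep := hy (v + τ • (z' - z))
  rw [add_sub_cancel_left, hsmul, abs_of_pos hτ] at hstep
  have h1 := hcoco (-(y - v))
  have h2 := mul_le_mul_of_nonneg_left (hcocoi (y - v)) (div_pos hL hLi).le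
  have hneg : N (-(y - v)) = N (y - v) := by simpa using hsmul (-1) (y - v)
  have hcancel : L / Li * (2 * Li * N (y - v) ^ 2) = 2 * L * N (y - v) ^ 2 := by
    field_simp
  rw [mul_add, hcancel] at h2
  rw [hneg] at h1
  have h3 : ⟪g v, y - v⟫ = ⟪a, y - v⟫ + ⟪g x - g v, -(y - v)⟫
      + L / Li * ⟪gi x - gi v, y - v⟫ := by
    rw [ha]
    simp only [inner_add_left, inner_smul_left, inner_sub_left, inner_neg_right]
    simp
    ring
  have h4 := mul_le_mul_of_nonneg_left hV (by positivity : 0 ≤ 9 * L * τ ^ 2)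
  have h5 : τ * ⟪a, z' - u⟫ = 9 * L * τ ^ 2 * (V z u - V z' u - V z z') := by
    rw [hmirror]; ring
  simp only [inner_add_right, inner_sub_right, inner_smul_right] at hstep h5 h3 h1 h2 hf ⊢
  linarith

end Step

/-- One outer loop.  Epoch `s` of PDASMD with `lIn ≥ 1` inner iterations.
The previous epoch's iterates `y_{sl−l+1}, …, y_{sl}` are recorded as `prevY 1, …, prevY lIn`
(so `Y 0 = y_{sl} = prevY lIn`) and `z_{sl} = z0`; `ṽ^s = (1/l) Σ_{j=1}^l prevY j`.  The
random indices of the epoch form `ω : Fin lIn → Fin m`, drawn independently with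
probabilities `p_i`, and `E[g] = Σ_ω (Π_j p_{ω j}) g(ω)`.  `Y j`, `Z j`, `Vv j` stand for
`y_{sl+j}`, `z_{sl+j}`, `v_{sl+j}` as functions of `ω`; adaptedness says that they depend
only on the indices drawn before inner step `j`.  The conclusion is the one-epoch bound of
Lemma 3 (with `φ* = φ(λ*)` the minimum of `φ`). -/
theorem pdasmd_one_outer_loop
    (dl m lIn : ℕ) (hm : 0 < m) (hl : 1 ≤ lIn)
    -- the norm ‖·‖_H and its dual norm ‖·‖_{H,*}
    (H : EuclideanSpace ℝ (Fin dl) → ℝ)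
    (hH_def : ∀ x, H x = 0 ↔ x = 0)
    (hH_smul : ∀ (c : ℝ) (x : EuclideanSpace ℝ (Fin dl)), H (c • x) = |c| * H x)
    (hH_tri : ∀ x y, H (x + y) ≤ H x + H y)
    (Hd : EuclideanSpace ℝ (Fin dl) → ℝ)
    (hHd : ∀ u, Hd u = sSup ((fun v => ⟪u, v⟫) '' {v | H v ≤ 1}))
    -- the finite-sum function φ = (1/m) Σ φᵢ, with gradients, attaining its minimum
    (φi : Fin m → EuclideanSpace ℝ (Fin dl) → ℝ)
    (gφi : Fin m → EuclideanSpace ℝ (Fin dl) → EuclideanSpace ℝ (Fin dl))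
    (hφi_conv : ∀ i, ConvexOn ℝ Set.univ (φi i))
    (hφi_diff : ∀ i x, HasGradientAt (φi i) (gφi i x) x)
    (Li : Fin m → ℝ) (hLi : ∀ i, 0 < Li i)
    (hφi_smooth : ∀ i x y, Hd (gφi i x - gφi i y) ≤ Li i * H (x - y))
    (Lbar : ℝ) (hLbar : Lbar = (∑ i, Li i) / m)
    (pr : Fin m → ℝ) (hpr : ∀ i, pr i = Li i / (m * Lbar))
    (φ : EuclideanSpace ℝ (Fin dl) → ℝ)
    (hφ : ∀ x, φ x = (1 / m : ℝ) * ∑ i, φi i x)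
    (gφ : EuclideanSpace ℝ (Fin dl) → EuclideanSpace ℝ (Fin dl))
    (hgφ : ∀ x, gφ x = (m : ℝ)⁻¹ • ∑ i, gφi i x)
    (lamstar : EuclideanSpace ℝ (Fin dl)) (hlamstar : ∀ lam, φ lamstar ≤ φ lam)
    -- the mirror map: differentiable, 1-strongly convex and γ-smooth w.r.t. ‖·‖_H
    (γ : ℝ) (w : EuclideanSpace ℝ (Fin dl) → ℝ)
    (gw : EuclideanSpace ℝ (Fin dl) → EuclideanSpace ℝ (Fin dl))
    (hw_diff : ∀ x, HasGradientAt w (gw x) x)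
    (hw_sc : ∀ x y, w x + ⟪gw x, y - x⟫ + (1 / 2) * H (y - x) ^ 2 ≤ w y)
    (hw_smooth : ∀ x y, Hd (gw x - gw y) ≤ γ * H (x - y))
    (Vb : EuclideanSpace ℝ (Fin dl) → EuclideanSpace ℝ (Fin dl) → ℝ)
    (hVb : ∀ x y, Vb x y = w y - w x - ⟪gw x, y - x⟫)
    -- step sizes of epoch s
    (s : ℕ) (τ1s τ1s' τ2 α : ℝ)
    (hτ1s : τ1s = 2 / ((s : ℝ) + 4)) (hτ1s' : τ1s' = 2 / ((s : ℝ) + 5))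
    (hτ2 : τ2 = 1 / 2) (hα : α = 1 / (9 * τ1s * Lbar))
    -- data from the previous epoch and the epoch initialization
    (prevY : ℕ → EuclideanSpace ℝ (Fin dl)) (z0 : EuclideanSpace ℝ (Fin dl))
    (vts : EuclideanSpace ℝ (Fin dl))
    (hvts : vts = ((1 : ℝ) / lIn) • ∑ j ∈ Finset.range lIn, prevY (j + 1))
    -- the iterates of the epoch, as functions of the epoch's random indices
    (Y Z Vv : ℕ → (Fin lIn → Fin m) → EuclideanSpace ℝ (Fin dl))
    (gt : Fin lIn → (Fin lIn → Fin m) → EuclideanSpace ℝ (Fin dl))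
    (hY0 : ∀ ω, Y 0 ω = prevY lIn) (hZ0 : ∀ ω, Z 0 ω = z0)
    (hVv : ∀ (j : Fin lIn) ω,
      Vv (j.1 + 1) ω = τ1s • Z j.1 ω + τ2 • vts + (1 - τ1s - τ2) • Y j.1 ω)
    (hgt : ∀ (j : Fin lIn) ω,
      gt j ω = gφ vts + (1 / (m * pr (ω j))) • (gφi (ω j) (Vv (j.1 + 1) ω) - gφi (ω j) vts))
    (hZstep : ∀ (j : Fin lIn) ω (z : EuclideanSpace ℝ (Fin dl)),
      (1 / α) * Vb (Z j.1 ω) (Z (j.1 + 1) ω) + ⟪gt j ω, Z (j.1 + 1) ω⟫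
        ≤ (1 / α) * Vb (Z j.1 ω) z + ⟪gt j ω, z⟫)
    (hYstep : ∀ (j : Fin lIn) ω (y : EuclideanSpace ℝ (Fin dl)),
      (9 * Lbar / 2) * H (Y (j.1 + 1) ω - Vv (j.1 + 1) ω) ^ 2 + ⟪gt j ω, Y (j.1 + 1) ω⟫
        ≤ (9 * Lbar / 2) * H (y - Vv (j.1 + 1) ω) ^ 2 + ⟪gt j ω, y⟫)
    -- adaptedness: the iterates at inner step j depend only on the indices drawn before j
    (hadapted : ∀ (j : ℕ) (ω ω' : Fin lIn → Fin m),
      (∀ j' : Fin lIn, (j' : ℕ) < j → ω j' = ω' j') → Y j ω = Y j ω' ∧ Z j ω = Z j ω')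
    -- the expectation over the epoch's randomness
    (Ex : ((Fin lIn → Fin m) → ℝ) → ℝ)
    (hEx : ∀ g, Ex g = ∑ ω : Fin lIn → Fin m, (∏ j, pr (ω j)) * g ω) :
    ∀ u : EuclideanSpace ℝ (Fin dl),
      (1 / τ1s) * ∑ j ∈ Finset.range lIn, Ex (fun ω => ⟪gφ (Vv (j + 1) ω), Vv (j + 1) ω - u⟫)
        + (τ2 / τ1s' ^ 2) * ∑ j ∈ Finset.range (lIn - 1), Ex (fun ω => φ (Y (j + 1) ω) - φ lamstar)
        + ((1 - τ1s') / τ1s' ^ 2) * Ex (fun ω => φ (Y lIn ω) - φ lamstar)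
      ≤ (1 / τ1s) * ∑ j ∈ Finset.range lIn, Ex (fun ω => φ (Vv (j + 1) ω) - φ lamstar)
        + ((1 - τ1s) / τ1s ^ 2) * Ex (fun ω => φ (Y 0 ω) - φ lamstar)
        + (τ2 / τ1s ^ 2) * ∑ j ∈ Finset.range (lIn - 1), (φ (prevY (j + 1)) - φ lamstar)
        + 9 * Lbar * (Ex (fun ω => Vb z0 u) - Ex (fun ω => Vb (Z lIn ω) u)) := by
  intro u
  have hmpos : (0 : ℝ) < m := Nat.cast_pos.2 hm
  have hlpos : (0 : ℝ) < lIn := Nat.cast_pos.2 hl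
  have : Nonempty (Fin m) := ⟨⟨0, hm⟩⟩
  have hsumL : ∑ i, Li i = m * Lbar := by rw [hLbar]; field_simp
  have hLpos : 0 < Lbar := by
    rw [hLbar]
    exact div_pos (Finset.sum_pos (fun i _ => hLi i) Finset.univ_nonempty) hmpos
  have hpr_nonneg : ∀ i, 0 ≤ pr i := fun i => by
    rw [hpr]
    exact (div_pos (hLi i) (mul_pos hmpos hLpos)).le
  have hpr_sum : ∑ i, pr i = 1 := by
    simp only [hpr]
    rw [← Finset.sum_div, hsumL, div_self (mul_pos hmpos hLpos).ne']
  have hs : (0 : ℝ) ≤ s := Nat.cast_nonneg s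
  have hτpos : 0 < τ1s := by rw [hτ1s]; positivity
  have hτle : τ1s ≤ 1 / 2 := by
    rw [hτ1s, div_le_iff₀ (by positivity)]
    linarith
  -- first-order bounds for the components and for their average
  have hdual := inner_le_dual_mul hH_def hH_smul hH_tri hHd
  have hHnn := norm_fun_nonneg hH_smul hH_tri
  have hi_conv : ∀ i x y, φi i x + ⟪gφi i x, y - x⟫ ≤ φi i y := fun i x y =>
    (hφi_conv i).add_inner_gradient_le (hφi_diff i x) y
  have hi_desc : ∀ i x y,
      φi i y ≤ φi i x + ⟪gφi i x, y - x⟫ + Li i / 2 * H (y - x) ^ 2 := fun i =>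
    le_add_inner_add_sq_of_smooth hH_smul (hφi_diff i) fun x y d =>
      (hdual _ d).trans (mul_le_mul_of_nonneg_right (hφi_smooth i x y) (hHnn d))
  have hg_inner : ∀ x d, ⟪gφ x, d⟫ = (1 / m : ℝ) * ∑ i, ⟪gφi i x, d⟫ := fun x d => by
    simp [hgφ, real_inner_smul_left, sum_inner]
  have hconv : ∀ x y, φ x + ⟪gφ x, y - x⟫ ≤ φ y := fun x y => by
    rw [hφ, hφ, hg_inner, ← mul_add, ← Finset.sum_add_distrib]
    exact mul_le_mul_of_nonneg_left (Finset.sum_le_sum fun i _ => hi_conv i x y) (by positivity)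
  have hdesc : ∀ x y, φ y ≤ φ x + ⟪gφ x, y - x⟫ + Lbar / 2 * H (y - x) ^ 2 := fun x y => by
    have h1 := mul_le_mul_of_nonneg_left (Finset.sum_le_sum fun i (_ : i ∈ Finset.univ) =>
      hi_desc i x y) (by positivity : (0 : ℝ) ≤ 1 / m)
    rw [Finset.sum_add_distrib, Finset.sum_add_distrib, ← Finset.sum_mul, ← Finset.sum_div, hsumL,
      mul_add, mul_add, ← hg_inner, ← hφ, ← hφ] at h1
    refine h1.trans_eq ?_
    field_simp
  -- the expectation is linear and monotone
  have hEx_add : ∀ a b, Ex (fun ω => a ω + b ω) = Ex a + Ex b := fun a b => by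
    simp [hEx, mul_add, Finset.sum_add_distrib]
  have hEx_mul : ∀ c a, Ex (fun ω => c * a ω) = c * Ex a := fun c a => by
    simp only [hEx, Finset.mul_sum]
    exact Finset.sum_congr rfl fun ω _ => by ring
  have hEx_const : ∀ c, Ex (fun _ => c) = c := fun c => by
    rw [hEx, ← Finset.sum_mul, sum_prod_eq_one hpr_sum, one_mul]
  have hEx_mono : ∀ a b, (∀ ω, a ω ≤ b ω) → Ex a ≤ Ex b := fun a b hab => by
    rw [hEx, hEx]
    exact Finset.sum_le_sum fun ω _ => mul_le_mul_of_nonneg_left (hab ω)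
      (Finset.prod_nonneg fun k _ => hpr_nonneg _)
  -- the one-step inequality in expectation
  have hstep : ∀ j ∈ Finset.range lIn,
      (1 / τ1s) * Ex (fun ω => ⟪gφ (Vv (j + 1) ω), Vv (j + 1) ω - u⟫)
        + (1 / τ1s ^ 2) * Ex (fun ω => φ (Y (j + 1) ω) - φ lamstar)
      ≤ (1 / τ1s) * Ex (fun ω => φ (Vv (j + 1) ω) - φ lamstar)
        + (τ2 / τ1s ^ 2) * (φ vts - φ lamstar)
        + ((1 - τ1s - τ2) / τ1s ^ 2) * Ex (fun ω => φ (Y j ω) - φ lamstar)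
        + 9 * Lbar * (Ex (fun ω => Vb (Z j ω) u) - Ex (fun ω => Vb (Z (j + 1) ω) u)) := by
    intro j hj
    obtain ⟨k, rfl⟩ : ∃ k : Fin lIn, (k : ℕ) = j := ⟨⟨j, Finset.mem_range.1 hj⟩, rfl⟩
    let B : EuclideanSpace ℝ (Fin dl) → ℝ := fun v => φ vts - φ v - ⟪gφ v, vts - v⟫
    let Bi : Fin m → EuclideanSpace ℝ (Fin dl) → ℝ := fun i v =>
      φi i vts - φi i v - ⟪gφi i v, vts - v⟫
    let G : Fin m → (Fin lIn → Fin m) → ℝ := fun i ω =>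
      φ (Vv (k + 1) ω) - φ lamstar + B (Vv (k + 1) ω) / 4
        + Lbar / Li i * (Bi i (Vv (k + 1) ω) / 4)
        - τ1s * ⟪gφ vts + (Lbar / Li i) • (gφi i (Vv (k + 1) ω) - gφi i vts), Z k ω - u⟫
    have hweight : ∀ i, 1 / (m * pr i) = Lbar / Li i := fun i => by
      have := hLi i
      rw [hpr]
      field_simp
    have hαinv : 1 / α = 9 * τ1s * Lbar := by rw [hα, one_div_one_div]
    have hpath : ∀ ω, φ (Y (k + 1) ω) - φ lamstar
        ≤ G (ω k) ω + 9 * Lbar * τ1s ^ 2 * (Vb (Z k ω) u + (-1) * Vb (Z (k + 1) ω) u) := by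
      intro ω
      have hmirror := inner_sub_eq_bregman_of_isMin hw_diff hVb (hZstep k ω) u
      rw [hαinv] at hmirror
      have hVlower : 1 / 2 * H (Z (k + 1) ω - Z k ω) ^ 2 ≤ Vb (Z k ω) (Z (k + 1) ω) := by
        rw [hVb]
        linarith [hw_sc (Z k ω) (Z (k + 1) ω)]
      have ha := hgt k ω
      rw [hweight] at ha
      have := coupled_step_le hH_smul hLpos (hLi (ω k)) hτpos
        (hdesc (Vv (k + 1) ω) (Y (k + 1) ω))
        (inner_sub_le_bregman_add_sq hH_smul hconv hdesc vts (Vv (k + 1) ω))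
        (inner_sub_le_bregman_add_sq hH_smul (hi_conv (ω k)) (hi_desc (ω k)) vts
          (Vv (k + 1) ω)) ha (hYstep k ω) hmirror hVlower
      simp only [G, B, Bi]
      rw [← ha]
      linarith
    have hGinv : ∀ i ω a, G i (Function.update ω k a) = G i ω := by
      intro i ω a
      obtain ⟨hYk, hZk⟩ := hadapted k (Function.update ω k a) ω fun j' hj' =>
        Function.update_of_ne (Fin.ne_of_lt hj') _ _
      have hVk : Vv (k + 1) (Function.update ω k a) = Vv (k + 1) ω := by
        rw [hVv, hVv, hYk, hZk]
      simp only [G, hVk, hZk]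
    have hGmean : ∀ ω, ∑ i, pr i * G i ω ≤ τ1s * (φ (Vv (k + 1) ω) - φ lamstar)
        + (τ2 * (φ vts - φ lamstar) + ((1 - τ1s - τ2) * (φ (Y k ω) - φ lamstar)
        + (-τ1s) * ⟪gφ (Vv (k + 1) ω), Vv (k + 1) ω - u⟫)) := by
      intro ω
      set v := Vv (k + 1) ω with hv
      have hpw : ∀ i, pr i * (Lbar / Li i) = 1 / m := fun i => by
        have := hLi i
        rw [hpr]
        field_simp
      have hterm : ∀ i, pr i * G i ω
          = pr i * (φ v - φ lamstar + B v / 4 - τ1s * ⟪gφ vts, Z k ω - u⟫)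
          + (1 / m : ℝ) * (Bi i v / 4 - τ1s * (⟪gφi i v, Z k ω - u⟫ - ⟪gφi i vts, Z k ω - u⟫)) := by
        intro i
        rw [← hpw i]
        simp only [G, ← hv, inner_add_left, real_inner_smul_left, inner_sub_left]
        ring
      have hmean : ∑ i, pr i * G i ω
          = φ v - φ lamstar + B v / 2 - τ1s * ⟪gφ v, Z k ω - u⟫ := by
        rw [Finset.sum_congr rfl fun i _ => hterm i, Finset.sum_add_distrib, ← Finset.sum_mul,
          hpr_sum, ← Finset.mul_sum]
        simp only [Bi, Finset.sum_sub_distrib, ← Finset.sum_div, ← Finset.mul_sum]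
        simp only [B, hg_inner, hφ]
        ring
      have hcomb : τ1s * ⟪gφ v, Z k ω - v⟫ + τ2 * ⟪gφ v, vts - v⟫
          + (1 - τ1s - τ2) * ⟪gφ v, Y k ω - v⟫ = 0 := by
        rw [← real_inner_smul_right, ← real_inner_smul_right, ← real_inner_smul_right,
          ← inner_add_right, ← inner_add_right]
        have : τ1s • (Z k ω - v) + τ2 • (vts - v) + (1 - τ1s - τ2) • (Y k ω - v) = 0 := by
          have h := hVv k ω
          rw [← hv] at h
          have h' : τ1s • (Z k ω - v) + τ2 • (vts - v) + (1 - τ1s - τ2) • (Y k ω - v)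
            = (τ1s • Z k ω + τ2 • vts + (1 - τ1s - τ2) • Y k ω) - v := by module
          rw [h', ← h, sub_self]
        rw [this, inner_zero_right]
      have hY := mul_le_mul_of_nonneg_left (hconv v (Y k ω))
        (by linarith : 0 ≤ 1 - τ1s - τ2)
      have hsplit : ⟪gφ v, Z k ω - u⟫ = ⟪gφ v, Z k ω - v⟫ + ⟪gφ v, v - u⟫ := by
        rw [← inner_add_right, sub_add_sub_cancel]
      rw [hmean, hsplit]
      subst hτ2
      simp only [B]
      linarith
    have hE1 := hEx_mono _ _ hpath
    rw [hEx_add, hEx_mul, hEx_add, hEx_mul] at hE1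
    have hE2 : Ex (fun ω => G (ω k) ω) = Ex (fun ω => ∑ i, pr i * G i ω) := by
      rw [hEx, hEx]
      exact sum_prod_mul_eq_sum_prod_mul_sum hpr_sum k G hGinv
    have hE3 := hEx_mono _ _ hGmean
    rw [hEx_add, hEx_mul, hEx_add, hEx_const, hEx_add, hEx_mul, hEx_mul] at hE3
    rw [hE2] at hE1
    have hfinal := mul_le_mul_of_nonneg_left (hE1.trans (add_le_add_left hE3 _))
      (by positivity : 0 ≤ 1 / τ1s ^ 2)
    have hne := hτpos.ne'
    refine le_of_sub_nonneg ?_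
    refine (sub_nonneg.2 hfinal).trans_eq ?_
    field_simp
    ring
  -- convexity at the averaged point
  have hjensen : (lIn : ℝ) * (φ vts - φ lamstar)
      ≤ ∑ j ∈ Finset.range lIn, (φ (prevY (j + 1)) - φ lamstar) := by
    have h1 := Finset.sum_le_sum fun j (_ : j ∈ Finset.range lIn) => hconv vts (prevY (j + 1))
    have h2 : ∑ j ∈ Finset.range lIn, (prevY (j + 1) - vts) = 0 := by
      rw [Finset.sum_sub_distrib, Finset.sum_const, Finset.card_range, hvts,
        ← Nat.cast_smul_eq_nsmul ℝ, smul_smul, mul_one_div_cancel hlpos.ne', one_smul, sub_self]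
    rw [Finset.sum_add_distrib, ← inner_sum, h2, inner_zero_right] at h1
    simp only [Finset.sum_sub_distrib, Finset.sum_const, Finset.card_range, nsmul_eq_mul] at h1 ⊢
    linarith
  -- telescoping over the epoch
  have hsum := Finset.sum_le_sum hstep
  have htel := Finset.sum_range_sub' (fun j => Ex (fun ω => Vb (Z j ω) u)) lIn
  simp only [Finset.sum_add_distrib, ← Finset.mul_sum, Finset.sum_const, Finset.card_range,
    nsmul_eq_mul, htel] at hsum
  obtain ⟨n, rfl⟩ : ∃ n, lIn = n + 1 := ⟨lIn - 1, by omega⟩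
  have hshift := Finset.sum_range_succ' (fun j => Ex (fun ω => φ (Y j ω) - φ lamstar)) n
  rw [hshift, Finset.sum_range_succ (fun j => Ex (fun ω => φ (Y (j + 1) ω) - φ lamstar)) n]
    at hsum
  rw [Finset.sum_range_succ] at hjensen
  have hY0' : Ex (fun ω => φ (Y 0 ω) - φ lamstar) = φ (prevY (n + 1)) - φ lamstar := by
    simp only [hY0, hEx_const]
  rw [← hY0'] at hjensen
  simp only [hZ0] at hsum
  have hgap : ∀ j, 0 ≤ Ex (fun ω => φ (Y j ω) - φ lamstar) := fun j => by
    rw [← hEx_const 0]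
    exact hEx_mono _ _ fun ω => sub_nonneg.2 (hlamstar _)
  have hS : 0 ≤ ∑ j ∈ Finset.range n, Ex (fun ω => φ (Y (j + 1) ω) - φ lamstar) :=
    Finset.sum_nonneg fun j _ => hgap _
  have hcoef1 : τ2 / τ1s' ^ 2 ≤ 1 / τ1s ^ 2 - (1 - τ1s - τ2) / τ1s ^ 2 := by
    rw [hτ1s, hτ1s', hτ2]
    field_simp
    nlinarith
  have hcoef2 : (1 - τ1s') / τ1s' ^ 2 ≤ 1 / τ1s ^ 2 := by
    rw [hτ1s, hτ1s']
    field_simp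
    nlinarith
  have h1 := mul_le_mul_of_nonneg_right hcoef1 hS
  have h2 := mul_le_mul_of_nonneg_right hcoef2 (hgap (n + 1))
  have h3 := mul_le_mul_of_nonneg_left hjensen
    (by rw [hτ2]; positivity : 0 ≤ τ2 / τ1s ^ 2)
  have h4 : (1 - τ1s) / τ1s ^ 2 = τ2 / τ1s ^ 2 + (1 - τ1s - τ2) / τ1s ^ 2 := by ring
  rw [Nat.add_sub_cancel, h4]
  linarith
end

section
/- (Semi-dual of entropic OT.) For every λ ∈ ℝⁿ, the map τ ↦ ψ(τ, λ) attains its minimum over ℝⁿ at τ(λ) defined by τ(λ)_i := η log p'_i − η log( Σ_{j=1}^n exp((λ_j − C_{ij} − η)/η) ), i.e. ψ(τ(λ), λ) ≤ ψ(τ, λ) for all τ ∈ ℝⁿ; moreover the minimum value equals the semi-dual: ψ(τ(λ), λ) = (1/n) Σ_{i=1}^n φ_i(λ). -/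
open scoped BigOperators

/-- The `i`-th semi-dual component of entropy-regularized optimal transport (here on the
plain function space `Fin n → ℝ`):
`φ_i(λ) = n p'_i ( −⟨q', λ⟩ − η log p'_i + η log( Σ_j exp((λ_j − C_{ij} − η)/η) ) + η )`. -/
noncomputable def otSemiDualComponent' (n : ℕ) (η : ℝ) (C : Fin n → Fin n → ℝ)
    (p' q' : Fin n → ℝ) (i : Fin n) (lam : Fin n → ℝ) : ℝ :=
  n * p' i * (-(∑ j, q' j * lam j) - η * Real.log (p' i)
    + η * Real.log (∑ j, Real.exp ((lam j - C i j - η) / η)) + η)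

/-- The exponential sum over a row factors through the dual variable of that row. -/
theorem sum_exp_add_div {ι : Type*} [Fintype ι] (η t : ℝ) (lam c : ι → ℝ) :
    ∑ j, Real.exp ((t + lam j - c j - η) / η)
      = Real.exp (t / η) * ∑ j, Real.exp ((lam j - c j - η) / η) := by
  rw [Finset.mul_sum]
  refine Finset.sum_congr rfl fun j _ => ?_
  rw [← Real.exp_add]
  congr 1
  ring

/-- At the critical point, `exp (t / η) * S = p`. -/
theorem exp_div_mul_of_log_sub_log {η p S : ℝ} (hη : η ≠ 0) (hp : 0 < p) (hS : 0 < S) :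
    Real.exp ((η * Real.log p - η * Real.log S) / η) * S = p := by
  rw [← mul_sub, mul_div_cancel_left₀ _ hη, Real.exp_sub, Real.exp_log hp, Real.exp_log hS,
    div_mul_cancel₀ _ hS.ne']

/-- If `exp (s / η) * S = p`, then `s` minimizes `t ↦ η * (exp (t / η) * S) - p * t`. -/
theorem exp_div_mul_sub_mul_le {η p S s : ℝ} (hη : 0 < η) (hp : 0 ≤ p)
    (hs : Real.exp (s / η) * S = p) (t : ℝ) :
    η * (Real.exp (s / η) * S) - p * s ≤ η * (Real.exp (t / η) * S) - p * t := by
  have ht : Real.exp (t / η) * S = p * Real.exp ((t - s) / η) := by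
    rw [← hs, mul_right_comm, ← Real.exp_add]
    congr 2
    ring
  have hexp := mul_le_mul_of_nonneg_left (Real.add_one_le_exp ((t - s) / η))
    (mul_nonneg hη.le hp)
  have hlin : η * p * ((t - s) / η + 1) = p * (t - s) + η * p := by
    field_simp
  rw [ht, hs]
  linarith

/-- Semi-dual of entropic OT.  For the entropic OT dual objective
`ψ(τ, λ) = η Σ_{i,j} exp((τ_i + λ_j − C_{ij} − η)/η) − ⟨p', τ⟩ − ⟨q', λ⟩`, the map
`τ ↦ ψ(τ, λ)` attains its minimum at `τ(λ)_i = η log p'_i − η log( Σ_j exp((λ_j − C_{ij} − η)/η) )`,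
and the minimum value equals the semi-dual `(1/n) Σ_i φ_i(λ)`. -/
theorem otSemiDual_is_partial_min (n : ℕ) (hn : 1 ≤ n) (η : ℝ) (hη : 0 < η)
    (C : Fin n → Fin n → ℝ) (p' q' : Fin n → ℝ)
    (hp_pos : ∀ i, 0 < p' i) (hq_nonneg : ∀ j, 0 ≤ q' j)
    (hp_sum : ∑ i, p' i = 1) (hq_sum : ∑ j, q' j = 1)
    (ψ : (Fin n → ℝ) → (Fin n → ℝ) → ℝ)
    (hψ : ∀ τ lam, ψ τ lam
      = η * ∑ i, ∑ j, Real.exp ((τ i + lam j - C i j - η) / η)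
        - ∑ i, p' i * τ i - ∑ j, q' j * lam j)
    (τopt : (Fin n → ℝ) → Fin n → ℝ)
    (hτopt : ∀ lam i, τopt lam i
      = η * Real.log (p' i) - η * Real.log (∑ j, Real.exp ((lam j - C i j - η) / η))) :
    ∀ lam : Fin n → ℝ,
      (∀ τ : Fin n → ℝ, ψ (τopt lam) lam ≤ ψ τ lam) ∧
      ψ (τopt lam) lam = (1 / n : ℝ) * ∑ i, otSemiDualComponent' n η C p' q' i lam := by
  intro lam
  have : Nonempty (Fin n) := ⟨⟨0, hn⟩⟩
  have hS : ∀ i, 0 < ∑ j, Real.exp ((lam j - C i j - η) / η) := fun i =>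
    Finset.sum_pos (fun j _ => Real.exp_pos _) Finset.univ_nonempty
  have hopt : ∀ i, Real.exp (τopt lam i / η) * ∑ j, Real.exp ((lam j - C i j - η) / η) = p' i :=
    fun i => by
      rw [hτopt]
      exact exp_div_mul_of_log_sub_log hη.ne' (hp_pos i) (hS i)
  have hψ' : ∀ τ, ψ τ lam
      = ∑ i, (η * (Real.exp (τ i / η) * ∑ j, Real.exp ((lam j - C i j - η) / η)) - p' i * τ i)
        - ∑ j, q' j * lam j := fun τ => by
    simp only [hψ, sum_exp_add_div, Finset.sum_sub_distrib, Finset.mul_sum]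
  refine ⟨fun τ => ?_, ?_⟩
  · rw [hψ', hψ']
    exact sub_le_sub_right (Finset.sum_le_sum fun i _ =>
      exp_div_mul_sub_mul_le hη (hp_pos i).le (hopt i) (τ i)) _
  · have hn' : (n : ℝ) ≠ 0 := by positivity
    have hq : ∑ j, q' j * lam j = ∑ i, p' i * ∑ j, q' j * lam j := by
      rw [← Finset.sum_mul, hp_sum, one_mul]
    rw [hψ', hq, ← Finset.sum_sub_distrib, Finset.mul_sum]
    refine Finset.sum_congr rfl fun i _ => ?_
    rw [hopt, hτopt, otSemiDualComponent']
    field_simp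
    ring
end
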